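/- arXiv:1509.01456 — 2 statements merged into one kernel-verified Lean document; each statement's English description precedes it below -/
import Mathlib

section
/- Let u and v be fuzzy numbers and let α ∈ [0,1]. If the right derivative u'₊(u⁻(α)) = φ, u(u⁻(α)) = β, and v(v⁻(α)) = γ with γ > β, then the right derivative of u∇v at (u∇v)⁻(β) equals φ, i.e., (u∇v)'₊((u∇v)⁻(β)) = φ. -/
open Set Filter Topology

/-- A fuzzy number: a function `ℝ → ℝ` taking values in `[0,1]`, whose `α`-cuts
(for `α ∈ (0,1]`) and whose `0`-cut (the closure of the support) are nonempty
compact intervals. -/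
structure FuzzyNumber where
  f : ℝ → ℝ
  mem_Icc : ∀ x, f x ∈ Set.Icc (0 : ℝ) 1
  cut_isIcc : ∀ α ∈ Set.Ioc (0 : ℝ) 1, ∃ a b : ℝ, a ≤ b ∧ {x | α ≤ f x} = Set.Icc a b
  supp_isIcc : ∃ a b : ℝ, a ≤ b ∧ closure {x | 0 < f x} = Set.Icc a b

namespace FuzzyNumber

/-- The `α`-cut of a fuzzy number; for `α = 0` it is the closure of the support. -/
noncomputable def cut (u : FuzzyNumber) (α : ℝ) : Set ℝ :=
  if α = 0 then closure {x | 0 < u.f x} else {x | α ≤ u.f x}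

/-- Left endpoint `u⁻(α)` of the `α`-cut. -/
noncomputable def lo (u : FuzzyNumber) (α : ℝ) : ℝ := sInf (u.cut α)

/-- Right endpoint `u⁺(α)` of the `α`-cut. -/
noncomputable def hi (u : FuzzyNumber) (α : ℝ) : ℝ := sSup (u.cut α)

/-- Left endpoint `u_s⁻(α)` of the strong `α`-cut: `lim_{β→α⁺} u⁻(β)` for `α < 1`,
and `u⁻(1)` for `α = 1`.  Since `u⁻` is nondecreasing, this right limit is the
infimum of `u⁻` over `(α,1]`. -/
noncomputable def slo (u : FuzzyNumber) (α : ℝ) : ℝ :=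
  if α < 1 then sInf (u.lo '' Set.Ioc α 1) else u.lo 1

/-- Right endpoint `u_s⁺(α)` of the strong `α`-cut: `lim_{β→α⁺} u⁺(β)` for `α < 1`,
and `u⁺(1)` for `α = 1`. -/
noncomputable def shi (u : FuzzyNumber) (α : ℝ) : ℝ :=
  if α < 1 then sSup (u.hi '' Set.Ioc α 1) else u.hi 1

/-- The sup-min convolution `u∇v` of two fuzzy numbers, as a function on `ℝ`:
`(u∇v)(x) = sup_y min (u y) (v (x - y))`.  Its cut functions satisfy
`(u∇v)⁻(α) = u⁻(α) + v⁻(α)` and `(u∇v)⁺(α) = u⁺(α) + v⁺(α)`. -/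
noncomputable def conv (u v : FuzzyNumber) (x : ℝ) : ℝ :=
  ⨆ y : ℝ, min (u.f y) (v.f (x - y))

end FuzzyNumber

/-- `f` has left derivative `f'` at `x`. -/
def HasLeftDerivAt (f : ℝ → ℝ) (f' x : ℝ) : Prop :=
  HasDerivWithinAt f f' (Set.Iio x) x

/-- `f` has right derivative `f'` at `x`. -/
def HasRightDerivAt (f : ℝ → ℝ) (f' x : ℝ) : Prop :=
  HasDerivWithinAt f f' (Set.Ioi x) x

namespace FuzzyNumber

lemma exists_cut_eq_Icc (u : FuzzyNumber) {t : ℝ} (ht : t ∈ Icc (0 : ℝ) 1) :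
    ∃ a b : ℝ, a ≤ b ∧ u.cut t = Icc a b := by
  rcases eq_or_ne t 0 with rfl | h0
  · simpa [cut] using u.supp_isIcc
  · simpa [cut, h0] using u.cut_isIcc t ⟨lt_of_le_of_ne ht.1 h0.symm, ht.2⟩

lemma lo_le (u : FuzzyNumber) {t x : ℝ} (ht : t ∈ Icc (0 : ℝ) 1) (hx : x ∈ u.cut t) :
    u.lo t ≤ x := by
  obtain ⟨a, b, -, h⟩ := u.exists_cut_eq_Icc ht
  exact csInf_le (h ▸ bddBelow_Icc) hx

lemma lo_mem_cut (u : FuzzyNumber) {t : ℝ} (ht : t ∈ Icc (0 : ℝ) 1) : u.lo t ∈ u.cut t := by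
  obtain ⟨a, b, hab, h⟩ := u.exists_cut_eq_Icc ht
  rw [lo, h, csInf_Icc hab]
  exact left_mem_Icc.2 hab

lemma mem_cut_of_lt (u : FuzzyNumber) {t x : ℝ} (h : t < u.f x) : x ∈ u.cut t := by
  unfold cut
  split_ifs with h0
  · exact subset_closure (h0 ▸ h)
  · exact h.le

lemma cut_subset_cut (u : FuzzyNumber) {s t : ℝ} (hs : 0 ≤ s) (hst : s ≤ t) :
    u.cut t ⊆ u.cut s := by
  rcases hst.eq_or_lt with rfl | hlt
  · rfl
  · intro x hx
    rw [cut, if_neg (hs.trans_lt hlt).ne'] at hx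
    exact u.mem_cut_of_lt (hlt.trans_le hx)

lemma le_f_lo (u : FuzzyNumber) {t : ℝ} (ht : t ∈ Icc (0 : ℝ) 1) : t ≤ u.f (u.lo t) := by
  rcases eq_or_ne t 0 with rfl | h0
  · exact (u.mem_Icc _).1
  · have h := u.lo_mem_cut ht
    rwa [cut, if_neg h0] at h

lemma f_le_of_lt_lo (u : FuzzyNumber) {t x : ℝ} (ht : t ∈ Icc (0 : ℝ) 1) (hx : x < u.lo t) :
    u.f x ≤ t := by
  by_contra! h
  exact (u.lo_le ht (u.mem_cut_of_lt h)).not_gt hx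

lemma lo_eq_lo (u : FuzzyNumber) {s t : ℝ} (hs : 0 ≤ s) (hst : s ≤ t)
    (h : t ≤ u.f (u.lo s)) : u.lo t = u.lo s := by
  have ht1 : t ≤ 1 := h.trans (u.mem_Icc _).2
  rcases hst.eq_or_lt with rfl | hlt
  · rfl
  · have ht : t ∈ Icc (0 : ℝ) 1 := ⟨hs.trans hst, ht1⟩
    refine le_antisymm (u.lo_le ht ?_) (u.lo_le ⟨hs, hst.trans ht1⟩
      (u.cut_subset_cut hs hst (u.lo_mem_cut ht)))
    rwa [cut, if_neg (hs.trans_lt hlt).ne']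

lemma f_lo_one (u : FuzzyNumber) : u.f (u.lo 1) = 1 :=
  le_antisymm (u.mem_Icc _).2 (u.le_f_lo ⟨zero_le_one, le_rfl⟩)

lemma monotoneOn_f (u : FuzzyNumber) : MonotoneOn u.f (Iic (u.lo 1)) := by
  intro y _ z hz hyz
  rcases (u.mem_Icc y).1.eq_or_lt with h0 | h0
  · exact h0 ▸ (u.mem_Icc z).1
  · obtain ⟨a, b, -, h⟩ := u.cut_isIcc (u.f y) ⟨h0, (u.mem_Icc y).2⟩
    have hy : y ∈ Icc a b := h ▸ le_refl (u.f y)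
    have hc : u.lo 1 ∈ Icc a b := by
      rw [← h, mem_ofPred_eq, f_lo_one]
      exact (u.mem_Icc y).2
    have hz' : z ∈ Icc a b := ⟨hy.1.trans hyz, le_trans hz hc.2⟩
    rwa [← h] at hz'

/-- Past `u⁻(β) + v⁻(β)`, and while the values of `u` stay below `v (v⁻(β))`, the convolution
`u∇v` is the translate of `u` by `v⁻(β)`. -/
lemma conv_eq_f_sub_lo (u v : FuzzyNumber) {β x : ℝ} (hβ : β ∈ Icc (0 : ℝ) 1)
    (hβx : β ≤ u.f (x - v.lo β)) (hx : x - v.lo β ≤ u.lo 1)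
    (hxv : u.f (x - v.lo β) ≤ v.f (v.lo β)) :
    u.conv v x = u.f (x - v.lo β) := by
  have key : ∀ y, min (u.f y) (v.f (x - y)) ≤ u.f (x - v.lo β) := by
    intro y
    rcases le_or_gt y (x - v.lo β) with hy | hy
    · exact (min_le_left _ _).trans (u.monotoneOn_f (hy.trans hx) hx hy)
    · exact (min_le_right _ _).trans ((v.f_le_of_lt_lo hβ (by linarith)).trans hβx)
  refine le_antisymm (ciSup_le key) ?_
  have h := le_ciSup (f := fun y => min (u.f y) (v.f (x - y)))
    ⟨_, forall_mem_range.2 key⟩ (x - v.lo β)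
  simpa [conv, hxv] using h

end FuzzyNumber

/-- Theorem `dbzeron`(iii): if `u'₊(u⁻(α)) = φ`, `u(u⁻(α)) = β`
and `v(v⁻(α)) = γ > β`, then `(u∇v)'₊((u∇v)⁻(β)) = φ`. -/
theorem conv_rightDeriv_eq (u v : FuzzyNumber) (α β γ φ : ℝ)
    (hα : α ∈ Set.Icc (0 : ℝ) 1)
    (hu : HasRightDerivAt u.f φ (u.lo α))
    (hβ : u.f (u.lo α) = β) (hγ : v.f (v.lo α) = γ) (hβγ : β < γ) :
    HasRightDerivAt (u.conv v) φ (u.lo β + v.lo β) := by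
  subst hβ
  set β := u.f (u.lo α) with hβ
  have hβI : β ∈ Icc (0 : ℝ) 1 := u.mem_Icc _
  have hαβ : α ≤ β := u.le_f_lo hα
  have hua : u.lo β = u.lo α := u.lo_eq_lo hα.1 hαβ hβ.le
  have hvb : v.lo β = v.lo α := v.lo_eq_lo hα.1 hαβ (hγ ▸ hβγ.le)
  have hβ1 : β < 1 := hβγ.trans_le (hγ ▸ (v.mem_Icc _).2)
  have hlt : u.lo α < u.lo 1 := by
    refine lt_of_le_of_ne (u.lo_le hα ?_) fun h => ?_
    · exact u.cut_subset_cut hα.1 hα.2 (u.lo_mem_cut ⟨zero_le_one, le_rfl⟩)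
    · rw [hβ, h, u.f_lo_one] at hβ1
      exact hβ1.false
  have hconv : ∀ z, u.lo α ≤ z → z ≤ u.lo 1 → u.f z ≤ γ →
      u.conv v (z + v.lo β) = u.f z := by
    intro z haz hz hzγ
    have h := u.conv_eq_f_sub_lo v (x := z + v.lo β) hβI
    simp only [add_sub_cancel_right] at h
    exact h (u.monotoneOn_f hlt.le hz haz) hz (by rwa [hvb, hγ])
  have hev : ∀ᶠ z in 𝓝[>] (u.lo α), u.conv v (z + v.lo β) = u.f z := by
    filter_upwards [hu.continuousWithinAt.eventually_lt_const hβγ, Ioo_mem_nhdsGT hlt]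
      with z hzγ hz
    exact hconv z hz.1.le hz.2.le hzγ.le
  have hd : HasDerivWithinAt (fun z => u.conv v (z + v.lo β)) φ (Ioi (u.lo α)) (u.lo α) :=
    HasDerivWithinAt.congr_of_eventuallyEq hu hev (hconv _ le_rfl hlt.le hβγ.le)
  rw [hua]
  have hd' : HasDerivWithinAt (fun z => u.conv v (z + v.lo β)) φ (Ioi (u.lo α))
      (u.lo α + v.lo β - v.lo β) := by rwa [add_sub_cancel_right]
  have hs : HasDerivWithinAt (fun x : ℝ => x - v.lo β) 1 (Ioi (u.lo α + v.lo β))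
      (u.lo α + v.lo β) := (hasDerivWithinAt_id _ _).sub_const _
  have h := hd'.comp (u.lo α + v.lo β) (h := fun x => x - v.lo β) hs fun _ hx =>
    mem_Ioi.2 (lt_sub_iff_add_lt.2 (mem_Ioi.1 hx))
  simpa [HasRightDerivAt, Function.comp_def] using h
end

section
/- Let u and v be fuzzy numbers and let α ∈ [0,1]. If the left derivative u'₋(u⁻(α)) = φ and the left limit lim_{y→v⁻(α)⁻} v(y) = λ with λ < α, then the left derivative of u∇v at (u∇v)⁻(α) equals φ, i.e., (u∇v)'₋((u∇v)⁻(α)) = φ. -/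
open Set Filter Topology

namespace FuzzyNumber

/-- The left endpoint of the `α`-cut is the least point at which `u` is at least `α`. -/
theorem isLeast_lo (u : FuzzyNumber) {α : ℝ} (hα : α ∈ Set.Ioc (0 : ℝ) 1) :
    IsLeast {x | α ≤ u.f x} (u.lo α) := by
  obtain ⟨a, b, hab, h⟩ := u.cut_isIcc α hα
  rw [lo, cut, if_neg hα.1.ne', h, csInf_Icc hab]
  exact isLeast_Icc hab

theorem le_f_lo_s5 (u : FuzzyNumber) {α : ℝ} (hα : α ∈ Set.Ioc (0 : ℝ) 1) :
    α ≤ u.f (u.lo α) :=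
  (u.isLeast_lo hα).1

theorem f_lt_of_lt_lo (u : FuzzyNumber) {α x : ℝ} (hα : α ∈ Set.Ioc (0 : ℝ) 1)
    (hx : x < u.lo α) : u.f x < α :=
  lt_of_not_ge fun h => hx.not_ge ((u.isLeast_lo hα).2 h)

/-- Fuzzy numbers are quasiconcave. -/
theorem min_le_f (u : FuzzyNumber) {x y z : ℝ} (hxy : x ≤ y) (hyz : y ≤ z) :
    min (u.f x) (u.f z) ≤ u.f y := by
  rcases le_or_gt (min (u.f x) (u.f z)) 0 with h | h
  · exact h.trans (u.mem_Icc y).1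
  · obtain ⟨a, b, -, hab⟩ := u.cut_isIcc _ ⟨h, (min_le_left _ _).trans (u.mem_Icc x).2⟩
    have hx : x ∈ Set.Icc a b := hab ▸ min_le_left (u.f x) (u.f z)
    have hz : z ∈ Set.Icc a b := hab ▸ min_le_right (u.f x) (u.f z)
    have hy : y ∈ Set.Icc a b := ⟨hx.1.trans hxy, hyz.trans hz.2⟩
    rwa [← hab] at hy

/-- A fuzzy number is nondecreasing to the left of the left endpoint of any of its cuts. -/
theorem monotoneOn_Iic_lo (u : FuzzyNumber) {α : ℝ} (hα : α ∈ Set.Ioc (0 : ℝ) 1) :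
    MonotoneOn u.f (Set.Iic (u.lo α)) := by
  intro x hx y hy hxy
  have hle : u.f x ≤ u.f (u.lo α) := by
    rcases eq_or_lt_of_le (Set.mem_Iic.1 hx) with h | h
    · rw [h]
    · exact (u.f_lt_of_lt_lo hα h).le.trans (u.le_f_lo_s5 hα)
  simpa [hle] using u.min_le_f hxy hy

/-- The left limit of `v` at the left endpoint of a cut bounds `v` to the left of it. -/
theorem f_le_of_tendsto_lo (v : FuzzyNumber) {α l y : ℝ} (hα : α ∈ Set.Ioc (0 : ℝ) 1)
    (hlim : Tendsto v.f (𝓝[<] (v.lo α)) (𝓝 l)) (hy : y < v.lo α) : v.f y ≤ l := by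
  refine ge_of_tendsto hlim ?_
  filter_upwards [Ioo_mem_nhdsLT hy] with t ht
  exact v.monotoneOn_Iic_lo hα hy.le ht.2.le ht.1.le

/-- If `u` is left continuous at the left endpoint of its `α`-cut, it takes the value `α` there. -/
theorem f_lo_eq (u : FuzzyNumber) {α : ℝ} (hα : α ∈ Set.Ioc (0 : ℝ) 1)
    (hu : ContinuousWithinAt u.f (Set.Iio (u.lo α)) (u.lo α)) : u.f (u.lo α) = α := by
  refine le_antisymm (le_of_tendsto hu ?_) (u.le_f_lo_s5 hα)
  filter_upwards [self_mem_nhdsWithin] with t ht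
  exact (u.f_lt_of_lt_lo hα ht).le

/-- The convolution `u∇v` agrees at `z` with the translate of `u` by `b` when the supremum
is attained at `z - b`. -/
theorem conv_eq_f_sub (u v : FuzzyNumber) {b z : ℝ} (hv : u.f (z - b) ≤ v.f b)
    (hleft : ∀ y ≤ z - b, u.f y ≤ u.f (z - b)) (hright : ∀ t < b, v.f t ≤ u.f (z - b)) :
    u.conv v z = u.f (z - b) := by
  have hub : ∀ y, min (u.f y) (v.f (z - y)) ≤ u.f (z - b) := by
    intro y
    rcases le_or_gt y (z - b) with hy | hy
    · exact (min_le_left _ _).trans (hleft y hy)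
    · exact (min_le_right _ _).trans (hright _ (by linarith))
  refine le_antisymm (ciSup_le hub) ?_
  refine le_ciSup_of_le ⟨_, Set.forall_mem_range.2 hub⟩ (z - b) ?_
  simpa using hv

end FuzzyNumber

/-- Theorem `dbzeron`(iv): if `u'₋(u⁻(α)) = φ` and
`lim_{y→v⁻(α)⁻} v(y) = λ < α`, then `(u∇v)'₋((u∇v)⁻(α)) = φ`. -/
theorem conv_leftDeriv_eq (u v : FuzzyNumber) (α φ lam : ℝ)
    (hα : α ∈ Set.Icc (0 : ℝ) 1)
    (hu : HasLeftDerivAt u.f φ (u.lo α))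
    (hlim : Filter.Tendsto v.f (nhdsWithin (v.lo α) (Set.Iio (v.lo α))) (nhds lam))
    (hlam : lam < α) :
    HasLeftDerivAt (u.conv v) φ (u.lo α + v.lo α) := by
  have hlam0 : 0 ≤ lam := ge_of_tendsto' hlim fun y => (v.mem_Icc y).1
  have hα' : α ∈ Set.Ioc (0 : ℝ) 1 := ⟨hlam0.trans_lt hlam, hα.2⟩
  have hcont : ContinuousWithinAt u.f (Set.Iio (u.lo α)) (u.lo α) := hu.continuousWithinAt
  have hua : u.f (u.lo α) = α := u.f_lo_eq hα' hcont
  have key : ∀ z ≤ u.lo α + v.lo α, lam < u.f (z - v.lo α) →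
      u.conv v z = u.f (z - v.lo α) := by
    intro z hz hlz
    have hz' : z - v.lo α ≤ u.lo α := by linarith
    have hmono := u.monotoneOn_Iic_lo hα'
    refine u.conv_eq_f_sub v ?_ (fun y hy => hmono (hy.trans hz') hz' hy) fun t ht =>
      (v.f_le_of_tendsto_lo hα' hlim ht).trans hlz.le
    exact ((hmono hz' Set.self_mem_Iic hz').trans_eq hua).trans (v.le_f_lo_s5 hα')
  have hsub : u.lo α + v.lo α - v.lo α = u.lo α := add_sub_cancel_right _ _
  have hmaps : Set.MapsTo (fun z => z - v.lo α) (Set.Iio (u.lo α + v.lo α))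
      (Set.Iio (u.lo α)) := fun _ hz => sub_lt_iff_lt_add.2 (Set.mem_Iio.1 hz)
  have hshift : HasDerivWithinAt (fun z => u.f (z - v.lo α)) φ
      (Set.Iio (u.lo α + v.lo α)) (u.lo α + v.lo α) := by
    have h := HasDerivWithinAt.comp_of_eq (u.lo α + v.lo α) hu
      ((hasDerivWithinAt_id _ _).sub_const (v.lo α)) hmaps hsub.symm
    rwa [mul_one] at h
  refine hshift.congr_of_eventuallyEq ?_ (key _ le_rfl (by rwa [hsub, hua]))
  have hev := hshift.continuousWithinAt.eventually_const_lt (u := lam)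
    (by simpa only [hsub, hua] using hlam)
  filter_upwards [hev, self_mem_nhdsWithin] with z hz hzlt
  exact key z (le_of_lt hzlt) hz
end
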